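/- arXiv:1906.01021 — 2 statements merged into one kernel-verified Lean document; each statement's English description precedes it below -/
import Mathlib

section
/- Let n ≥ 1, let P be a real symmetric n×n matrix with P𝟙 = 𝟙, let λ > 0 and ℓ ∈ ℕ, and suppose f ∈ ℝ^n lies in the span of eigenvectors of P whose eigenvalues μ satisfy |μ| ≥ λ. Then for every u ∈ ℝ^n: |(1/n)·Σ_{i=1}^n f_i − Σ_{i=1}^n u_i f_i| ≤ (‖f‖₂/λ^ℓ) · ‖P^ℓ u − (1/n)𝟙‖₂. -/
open Matrix

/-- Parseval's identity for the orthonormal eigenbasis of a real Hermitian matrix. -/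
theorem Matrix.IsHermitian.sum_dotProduct_eigenvectorBasis_mul {ι : Type*} [Fintype ι]
    [DecidableEq ι] {P : Matrix ι ι ℝ} (hP : P.IsHermitian) (x y : ι → ℝ) :
    ∑ j, (⇑(hP.eigenvectorBasis j) ⬝ᵥ x) * (⇑(hP.eigenvectorBasis j) ⬝ᵥ y) = x ⬝ᵥ y := by
  have h := hP.eigenvectorBasis.sum_inner_mul_inner (WithLp.toLp 2 x) (WithLp.toLp 2 y)
  simp only [EuclideanSpace.inner_eq_star_dotProduct, star_trivial] at h
  rw [dotProduct_comm x y, ← h]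
  exact Finset.sum_congr rfl fun j _ => by rw [dotProduct_comm y]

theorem Matrix.IsSymm.dotProduct_mulVec_of_mulVec_eq_smul {ι : Type*} [Fintype ι]
    {P : Matrix ι ι ℝ} (hP : P.IsSymm) {v : ι → ℝ} {μ : ℝ} (hv : P *ᵥ v = μ • v)
    (x : ι → ℝ) : v ⬝ᵥ (P *ᵥ x) = μ * (v ⬝ᵥ x) := by
  rw [dotProduct_mulVec, ← mulVec_transpose, hP.eq, hv, smul_dotProduct, smul_eq_mul]

theorem Matrix.IsSymm.dotProduct_pow_mulVec_of_mulVec_eq_smul {ι : Type*} [Fintype ι]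
    [DecidableEq ι] {P : Matrix ι ι ℝ} (hP : P.IsSymm) {v : ι → ℝ} {μ : ℝ}
    (hv : P *ᵥ v = μ • v) (x : ι → ℝ) (k : ℕ) :
    v ⬝ᵥ (P ^ k *ᵥ x) = μ ^ k * (v ⬝ᵥ x) := by
  induction k with
  | zero => simp
  | succ k ih =>
    rw [pow_succ', ← mulVec_mulVec, hP.dotProduct_mulVec_of_mulVec_eq_smul hv, ih]
    ring

/-- A vector in the span of eigenvectors with eigenvalues at least `lam` in absolute value is
orthogonal to every eigenvector with eigenvalue less than `lam` in absolute value. -/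
theorem Matrix.IsSymm.dotProduct_eq_zero_of_mem_span {ι : Type*} [Fintype ι]
    {P : Matrix ι ι ℝ} (hP : P.IsSymm) {v : ι → ℝ} {ν lam : ℝ} (hv : P *ᵥ v = ν • v)
    (hν : |ν| < lam) {f : ι → ℝ}
    (hf : f ∈ Submodule.span ℝ
      {v : ι → ℝ | v ≠ 0 ∧ ∃ μ : ℝ, lam ≤ |μ| ∧ P *ᵥ v = μ • v}) :
    v ⬝ᵥ f = 0 := by
  induction hf using Submodule.span_induction with
  | mem x hx =>
    obtain ⟨-, μ, hμ, hx⟩ := hx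
    have h := hP.dotProduct_mulVec_of_mulVec_eq_smul hv x
    rw [hx, dotProduct_smul, smul_eq_mul] at h
    have hne : μ ≠ ν := by
      rintro rfl
      exact hν.not_ge hμ
    exact (mul_eq_mul_right_iff.mp h).resolve_left hne
  | zero => simp
  | add x y _ _ hx hy => rw [dotProduct_add, hx, hy, add_zero]
  | smul c x _ hx => rw [dotProduct_smul, hx, smul_zero]

theorem Matrix.IsSymm.pow_mul_abs_dotProduct_le {ι : Type*} [Fintype ι] [DecidableEq ι]
    {P : Matrix ι ι ℝ} (hP : P.IsSymm) {lam : ℝ} (hlam : 0 ≤ lam) (k : ℕ) {f : ι → ℝ}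
    (hf : f ∈ Submodule.span ℝ
      {v : ι → ℝ | v ≠ 0 ∧ ∃ μ : ℝ, lam ≤ |μ| ∧ P *ᵥ v = μ • v}) (w : ι → ℝ) :
    lam ^ k * |f ⬝ᵥ w| ≤ √(f ⬝ᵥ f) * √((P ^ k *ᵥ w) ⬝ᵥ (P ^ k *ᵥ w)) := by
  have hH : P.IsHermitian := by
    rw [IsHermitian, conjTranspose_eq_transpose_of_trivial]
    exact hP
  have hb := hH.mulVec_eigenvectorBasis
  rw [← hH.sum_dotProduct_eigenvectorBasis_mul f w, ← hH.sum_dotProduct_eigenvectorBasis_mul f f,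
    ← hH.sum_dotProduct_eigenvectorBasis_mul (P ^ k *ᵥ w)]
  set b := hH.eigenvectorBasis
  calc lam ^ k * |∑ j, (⇑(b j) ⬝ᵥ f) * (⇑(b j) ⬝ᵥ w)|
      ≤ lam ^ k * ∑ j, |(⇑(b j) ⬝ᵥ f) * (⇑(b j) ⬝ᵥ w)| := by
        gcongr
        exact Finset.abs_sum_le_sum_abs _ _
    _ ≤ ∑ j, |⇑(b j) ⬝ᵥ f| * |⇑(b j) ⬝ᵥ (P ^ k *ᵥ w)| := by
        rw [Finset.mul_sum]
        refine Finset.sum_le_sum fun j _ => ?_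
        rcases lt_or_ge |hH.eigenvalues j| lam with h | h
        · simp [hP.dotProduct_eq_zero_of_mem_span (hb j) h hf]
        · rw [hP.dotProduct_pow_mulVec_of_mulVec_eq_smul (hb j), abs_mul, abs_mul, abs_pow,
            mul_left_comm]
          gcongr
    _ ≤ _ := by
        simpa only [sq_abs, ← pow_two] using Real.sum_mul_le_sqrt_mul_sqrt Finset.univ
          (fun j => |⇑(b j) ⬝ᵥ f|) (fun j => |⇑(b j) ⬝ᵥ (P ^ k *ᵥ w)|)

theorem Matrix.pow_mulVec_eq_self {ι : Type*} [Fintype ι] [DecidableEq ι]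
    {P : Matrix ι ι ℝ} {v : ι → ℝ} (hv : P *ᵥ v = v) (k : ℕ) : P ^ k *ᵥ v = v := by
  induction k with
  | zero => simp
  | succ k ih => rw [pow_succ, ← mulVec_mulVec, hv, ih]


/-- Sampling-error bound (paper's Theorem 2 core estimate): if `P` is a symmetric real
`n × n` matrix with `P 𝟙 = 𝟙`, and `f` lies in the span of eigenvectors of `P` whose
eigenvalues `μ` satisfy `|μ| ≥ λ`, then for every weight vector `u`,
`|(1/n) Σ f_i - Σ u_i f_i| ≤ (‖f‖₂ / λ^ℓ) · ‖P^ℓ u - (1/n)𝟙‖₂`. -/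
theorem stmt6 (n : ℕ) (hn : 1 ≤ n) (P : Matrix (Fin n) (Fin n) ℝ)
    (hPsymm : P.IsSymm)
    (hPone : P.mulVec (fun _ => 1) = fun _ => 1)
    (lam : ℝ) (hlam : 0 < lam) (ℓ : ℕ)
    (f : Fin n → ℝ)
    (hf : f ∈ Submodule.span ℝ
        {v : Fin n → ℝ | v ≠ 0 ∧ ∃ μ : ℝ, lam ≤ |μ| ∧ P.mulVec v = μ • v}) :
    ∀ u : Fin n → ℝ,
      |(1 / (n : ℝ)) * ∑ i, f i - ∑ i, u i * f i|
        ≤ (Real.sqrt (∑ i, f i ^ 2) / lam ^ ℓ) *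
            Real.sqrt (∑ i, ((P ^ ℓ).mulVec u i - 1 / (n : ℝ)) ^ 2) := by
  intro u
  set c : Fin n → ℝ := (1 / (n : ℝ)) • fun _ => 1 with hc
  have hPc : P ^ ℓ *ᵥ (u - c) = P ^ ℓ *ᵥ u - c := by
    rw [mulVec_sub, hc, mulVec_smul, pow_mulVec_eq_self hPone]
  have h := hPsymm.pow_mul_abs_dotProduct_le hlam.le ℓ hf (u - c)
  have hfw : |(1 / (n : ℝ)) * ∑ i, f i - ∑ i, u i * f i| = |f ⬝ᵥ (u - c)| := by
    rw [abs_sub_comm, Finset.mul_sum, ← Finset.sum_sub_distrib]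
    congr 1
    refine Finset.sum_congr rfl fun i _ => ?_
    simp only [hc, Pi.sub_apply, Pi.smul_apply, smul_eq_mul]
    ring
  rw [hfw, div_mul_eq_mul_div, le_div_iff₀ (pow_pos hlam ℓ), mul_comm]
  rw [hPc] at h
  simpa [dotProduct, hc, ← pow_two] using h
end

section
/- Let n ≥ 1, let P be a real n×n matrix with nonnegative entries whose every column is nonzero and sums to 1, and let κ ∈ (0,1]. Suppose the index j satisfies ⟨P_j/‖P_j‖₂, (1/√n)𝟙⟩ ≥ κ · max_i ⟨P_i/‖P_i‖₂, (1/√n)𝟙⟩ (i.e., the first greedily chosen column is within a factor κ of the best-aligned normalized column). Then ⟨P_j/‖P_j‖₂, (1/√n)𝟙⟩ ≥ κ/(√n · Σ_{i=1}^n ‖P_i‖₂). -/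
/-- If `v` sums to `1`, then the inner product of `v / a` with the constant vector `b` is `b / a`. -/
theorem sum_div_mul_of_sum_eq_one {ι : Type*} [Fintype ι] {v : ι → ℝ} (hv : ∑ l, v l = 1)
    (a b : ℝ) : ∑ l, v l / a * b = b / a := by
  rw [← Finset.sum_mul, ← Finset.sum_div, hv, one_div_mul_eq_div]

/-- The Euclidean norm of a nonzero vector is positive. -/
theorem sqrt_sum_sq_pos {ι : Type*} [Fintype ι] {v : ι → ℝ} (hv : v ≠ 0) :
    0 < Real.sqrt (∑ m, v m ^ 2) := by
  obtain ⟨m, hm⟩ := Function.ne_iff.mp hv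
  exact Real.sqrt_pos.mpr <| Finset.sum_pos' (fun i _ => sq_nonneg (v i))
    ⟨m, Finset.mem_univ m, sq_pos_of_ne_zero hm⟩

/-- Initialization lemma for the cost-aware greedy algorithm: if the first chosen column
`j` of a column-stochastic nonnegative matrix `P` (with nonzero columns) is within a
factor `κ` of the best-aligned normalized column, i.e.
`⟨P_j/‖P_j‖, (1/√n)𝟙⟩ ≥ κ · max_i ⟨P_i/‖P_i‖, (1/√n)𝟙⟩`, then
`⟨P_j/‖P_j‖, (1/√n)𝟙⟩ ≥ κ/(√n · Σ_i ‖P_i‖)`. -/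
theorem stmt8 (n : ℕ) (hn : 1 ≤ n) (P : Matrix (Fin n) (Fin n) ℝ)
    (hPnonneg : ∀ i j, 0 ≤ P i j)
    (hPcolsum : ∀ i, ∑ j, P j i = 1)
    (hPcolne : ∀ i, (fun j => P j i) ≠ (0 : Fin n → ℝ))
    (κ : ℝ) (hκ0 : 0 < κ) (hκ1 : κ ≤ 1)
    (j : Fin n)
    (hj : κ * (Finset.univ.sup' ⟨(⟨0, hn⟩ : Fin n), Finset.mem_univ _⟩
          (fun i => ∑ l, (P l i / Real.sqrt (∑ m, P m i ^ 2)) * (1 / Real.sqrt n)))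
        ≤ ∑ l, (P l j / Real.sqrt (∑ m, P m j ^ 2)) * (1 / Real.sqrt n)) :
    κ / (Real.sqrt n * ∑ i, Real.sqrt (∑ m, P m i ^ 2))
      ≤ ∑ l, (P l j / Real.sqrt (∑ m, P m j ^ 2)) * (1 / Real.sqrt n) := by
  have hle : Real.sqrt (∑ m, P m j ^ 2) ≤ ∑ i, Real.sqrt (∑ m, P m i ^ 2) :=
    Finset.single_le_sum (f := fun i => Real.sqrt (∑ m, P m i ^ 2))
      (fun i _ => Real.sqrt_nonneg _) (Finset.mem_univ j)
  have hpos : 0 < Real.sqrt (∑ m, P m j ^ 2) := sqrt_sum_sq_pos (hPcolne j)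
  have hn' : 0 < Real.sqrt n := Real.sqrt_pos.mpr (by exact_mod_cast hn)
  rw [sum_div_mul_of_sum_eq_one (hPcolsum j), div_div]
  gcongr
end
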